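/- Identify ℂ² with ℝ⁴ with coordinates (x₁, y₁, x₂, y₂), let a < b < 0 be real numbers, and define σ : ℝ⁴ → ℝ by σ(p) = a·(x₁² + y₁²) + b·(x₂² + y₂²), the vector field E₂(p) = ((x₂² + y₂²)·x₁, (x₂² + y₂²)·y₁, −(x₁² + y₁²)·x₂, −(x₁² + y₁²)·y₂), and the function s : (a, b) → ℝ by s(t) = (b/2)·ln(b − t) − (a/2)·ln(t − a). Then for every point p with x₁² + y₁² + x₂² + y₂² = 1, x₁² + y₁² ≠ 0 and x₂² + y₂² ≠ 0 (so that σ(p) ∈ (a, b) and σ(p) ≠ 0), the directional derivative of the composite function s ∘ σ at p in the direction σ(p)⁻¹·E₂(p) equals 1. -/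

import Mathlib

/-- The moment-type function `σ(p) = a(x₁² + y₁²) + b(x₂² + y₂²)` on `ℝ⁴`,
in coordinates `p = (x₁, y₁, x₂, y₂)`. -/
def sigmaFn (a b : ℝ) : (Fin 4 → ℝ) → ℝ :=
  fun p => a * (p 0 ^ 2 + p 1 ^ 2) + b * (p 2 ^ 2 + p 3 ^ 2)

/-- The vector field `E₂ = (|z₂|² x₁, |z₂|² y₁, −|z₁|² x₂, −|z₁|² y₂)`. -/
def E2Field : (Fin 4 → ℝ) → (Fin 4 → ℝ) :=
  fun p => ![(p 2 ^ 2 + p 3 ^ 2) * p 0, (p 2 ^ 2 + p 3 ^ 2) * p 1,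
    -((p 0 ^ 2 + p 1 ^ 2) * p 2), -((p 0 ^ 2 + p 1 ^ 2) * p 3)]

/-- The arclength-type parameter `s(t) = (b/2)·ln(b − t) − (a/2)·ln(t − a)`. -/
noncomputable def sParam (a b : ℝ) : ℝ → ℝ :=
  fun t => b / 2 * Real.log (b - t) - a / 2 * Real.log (t - a)

/-- The derivative of `σ`, as a continuous linear form. -/
theorem hasFDerivAt_sigmaFn (a b : ℝ) (p : Fin 4 → ℝ) :
    HasFDerivAt (sigmaFn a b)
      ((2 * a * p 0) • ContinuousLinearMap.proj (R := ℝ) (φ := fun _ : Fin 4 => ℝ) 0 +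
        (2 * a * p 1) • ContinuousLinearMap.proj 1 +
        (2 * b * p 2) • ContinuousLinearMap.proj 2 +
        (2 * b * p 3) • ContinuousLinearMap.proj 3) p := by
  have h (i : Fin 4) := (hasFDerivAt_apply (𝕜 := ℝ) i p).pow 2
  refine ((((h 0).add (h 1)).const_mul a).add (((h 2).add (h 3)).const_mul b)).congr_fderiv ?_
  ext v
  simp
  ring

/-- The derivative of `σ` along `E₂` is `-2 (b - a) |z₁|² |z₂|²`. -/
theorem fderiv_sigmaFn_E2Field (a b : ℝ) (p : Fin 4 → ℝ) :
    fderiv ℝ (sigmaFn a b) p (E2Field p) =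
      -(2 * (b - a) * (p 0 ^ 2 + p 1 ^ 2) * (p 2 ^ 2 + p 3 ^ 2)) := by
  rw [(hasFDerivAt_sigmaFn a b p).fderiv]
  simp [E2Field]
  ring

/-- The derivative of `s` away from its two endpoints. -/
theorem hasDerivAt_sParam {a b t : ℝ} (ha : t - a ≠ 0) (hb : b - t ≠ 0) :
    HasDerivAt (sParam a b) (-(b / 2 / (b - t)) - a / 2 / (t - a)) t := by
  refine (((((hasDerivAt_id t).const_sub b).log hb).const_mul (b / 2)).sub
    ((((hasDerivAt_id t).sub_const a).log ha).const_mul (a / 2))).congr_deriv ?_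
  simp only [id_eq]
  ring

/-- On the unit sphere away from the two circles `z₁ = 0`, `z₂ = 0`, the
directional derivative of `s ∘ σ` in the direction `σ⁻¹ E₂` equals `1`:
`X = σ⁻¹E₂` is unit speed for the parameter `s(σ)`. -/
theorem arclength_parameter_unit_speed (a b : ℝ) (hab : a < b) (hb : b < 0)
    (p : Fin 4 → ℝ)
    (hnorm : p 0 ^ 2 + p 1 ^ 2 + p 2 ^ 2 + p 3 ^ 2 = 1)
    (h1 : p 0 ^ 2 + p 1 ^ 2 ≠ 0) (h2 : p 2 ^ 2 + p 3 ^ 2 ≠ 0) :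
    fderiv ℝ (sParam a b ∘ sigmaFn a b) p ((sigmaFn a b p)⁻¹ • E2Field p) = 1 := by
  set u := p 0 ^ 2 + p 1 ^ 2 with hu
  set v := p 2 ^ 2 + p 3 ^ 2 with hv
  have huv : u + v = 1 := by linarith
  have hba : b - a ≠ 0 := (sub_pos.2 hab).ne'
  have hσ : sigmaFn a b p = a * u + b * v := rfl
  have hσb : b - sigmaFn a b p = (b - a) * u := by
    rw [hσ]; linear_combination -b * huv
  have hσa : sigmaFn a b p - a = (b - a) * v := by
    rw [hσ]; linear_combination a * huv
  have hσ0 : a * u + b * v ≠ 0 := by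
    have hu0 : 0 ≤ u := by positivity
    have hv0 : 0 ≤ v := by positivity
    have hneg : a * u + b * v < 0 := by nlinarith
    exact hneg.ne
  have hs := hasDerivAt_sParam (a := a) (b := b) (t := sigmaFn a b p)
    (by rw [hσa]; exact mul_ne_zero hba h2) (by rw [hσb]; exact mul_ne_zero hba h1)
  have hd := (hasFDerivAt_sigmaFn a b p).differentiableAt
  rw [(hs.comp_hasFDerivAt p hd.hasFDerivAt).fderiv, smul_apply, map_smul,
    fderiv_sigmaFn_E2Field, hσb, hσa, hσ, ← hu, ← hv, smul_eq_mul, smul_eq_mul]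
  field_simp
  ring
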